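/- arXiv:2206.13308 — 4 statements merged into one kernel-verified Lean document; each statement's English description precedes it below -/
import Mathlib

section
/- Let n ≥ 4 and 1 ≤ t ≤ n−3. Then G_{n,t} is isomorphic to G_{n,n−2−t}; an isomorphism is induced by the automorphism of A(Δ_n) sending a_i to a_i^{−1} for 1 ≤ i ≤ n. -/
/- Scaffolding: braid/commuting predicates, ordered products, cycle and twisted
cycle commutators, and the Artin groups of the diagrams `Δ_n`, `Δ_{t,n}`, `D_n`
(generators numbered `1, …, n` as in the paper, realized on the index type `Fin n`). -/

namespace ArtinPaper

open scoped commutatorElement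

/-- `BR u v` : `u` and `v` braid, i.e. `u v u = v u v`. -/
def BR {G : Type*} [Group G] (u v : G) : Prop := u * v * u = v * u * v

/-- `CM u v` : `u` and `v` commute, i.e. `u v = v u`. -/
def CM {G : Type*} [Group G] (u v : G) : Prop := u * v = v * u

/-- `mulIcc y a b = y a * y (a+1) * ⋯ * y b` (equal to `1` when `a > b`). -/
def mulIcc {M : Type*} [Monoid M] (y : ℕ → M) (a b : ℕ) : M :=
  ((List.range (b + 1 - a)).map fun i => y (a + i)).prod

/-- The cycle commutator
`cc(y₁,…,yₙ) = [y₁, y₂ ⋯ y_{n-1} yₙ y_{n-1}⁻¹ ⋯ y₂⁻¹]`. -/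
def cc {G : Type*} [Group G] (y : ℕ → G) (n : ℕ) : G :=
  ⁅y 1, mulIcc y 2 (n - 1) * y n * (mulIcc y 2 (n - 1))⁻¹⁆

/-- The `t`-twisted cycle commutator
`tc_t(y₁,…,yₙ) = [y₁, y₂⁻¹ ⋯ y_{t+1}⁻¹ y_{t+2} ⋯ y_{n-1} yₙ y_{n-1}⁻¹ ⋯ y_{t+2}⁻¹ y_{t+1} ⋯ y₂]`.
(The twisted cycle commutator `tc(y₁,y₂,y₃,y₄)` is `tc y 4 1`.) -/
def tc {G : Type*} [Group G] (y : ℕ → G) (n t : ℕ) : G :=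
  ⁅y 1, mulIcc (fun i => (y i)⁻¹) 2 (t + 1) *
      (mulIcc y (t + 2) (n - 1) * y n * (mulIcc y (t + 2) (n - 1))⁻¹) *
      (mulIcc (fun i => (y i)⁻¹) 2 (t + 1))⁻¹⁆

/-- The `i`-th generator (numbered `1, …, n`) of the free group on `Fin n`. -/
def gen (n i : ℕ) : FreeGroup (Fin n) :=
  if h : 0 < n then FreeGroup.of ⟨(i - 1) % n, Nat.mod_lt _ h⟩ else 1

/-- The braid relator `u v u (v u v)⁻¹`. -/
def braidRel {G : Type*} [Group G] (u v : G) : G := u * v * u * (v * u * v)⁻¹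

/-- Artin-type relations on generators `1, …, n` determined by an edge predicate `E`:
generators joined by an edge braid, all other pairs of generators commute. -/
def relsOf (n : ℕ) (E : ℕ → ℕ → Prop) : Set (FreeGroup (Fin n)) :=
  { w | ∃ i j, 1 ≤ i ∧ i < j ∧ j ≤ n ∧
      ((E i j ∧ w = braidRel (gen n i) (gen n j)) ∨
       (¬ E i j ∧ w = ⁅gen n i, gen n j⁆)) }

/-- Edges of the `n`-cycle `Δ_n`: `{i, i+1}` for `1 ≤ i ≤ n-1`, and `{1, n}`. -/
def cycEdge (n i j : ℕ) : Prop := (1 ≤ i ∧ i + 1 ≤ n ∧ j = i + 1) ∨ (i = 1 ∧ j = n)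

/-- Defining relations of the Artin group `A(Δ_n)` of the `n`-cycle. -/
def cycleRels (n : ℕ) : Set (FreeGroup (Fin n)) := relsOf n (cycEdge n)

/-- Edges of the diagram `Δ_{t,n}`, where `r = n - 3 - t` and the generators are
`b_1, …, b_{4+r}` (vertices `1, …, 4+r`) and `c_{5+r}, …, c_n` (vertices `5+r, …, n`):
the braiding pairs are `{b_1,b_2}, {b_2,b_3}, {b_3,b_1}, {b_4,b_1}, {b_1,b_5}`,
`{b_i,b_{i+1}}` for `5 ≤ i ≤ 3+r`, `{b_3,c_{5+r}}`, and `{c_i,c_{i+1}}` for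
`5+r ≤ i ≤ n-1`. -/
def deltaEdge (n t i j : ℕ) : Prop :=
  (i = 1 ∧ j = 2) ∨ (i = 2 ∧ j = 3) ∨ (i = 1 ∧ j = 3) ∨ (i = 1 ∧ j = 4) ∨
  (i = 1 ∧ j = 5 ∧ 5 ≤ 4 + (n - 3 - t)) ∨
  (5 ≤ i ∧ i + 1 ≤ 4 + (n - 3 - t) ∧ j = i + 1) ∨
  (i = 3 ∧ j = 5 + (n - 3 - t) ∧ 5 + (n - 3 - t) ≤ n) ∨
  (5 + (n - 3 - t) ≤ i ∧ i + 1 ≤ n ∧ j = i + 1)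

/-- Defining relations of the Artin group `A(Δ_{t,n})`. -/
def deltaRels (n t : ℕ) : Set (FreeGroup (Fin n)) := relsOf n (deltaEdge n t)

/-- Edges of the Coxeter diagram `D_n`: `{1,3}, {2,3}`, and `{i, i+1}` for
`3 ≤ i ≤ n-1` (in particular `1` and `2` are not joined, so `x_1 x_2 = x_2 x_1`). -/
def dEdge (n i j : ℕ) : Prop :=
  (i = 1 ∧ j = 3) ∨ (i = 2 ∧ j = 3) ∨ (3 ≤ i ∧ i + 1 ≤ n ∧ j = i + 1)

/-- Defining relations of the Artin group `A(D_n)` of type `D_n`. -/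
def dRels (n : ℕ) : Set (FreeGroup (Fin n)) := relsOf n (dEdge n)

/-- The Artin group `A(D_n)` of type `D_n`. -/
abbrev ArtinD (n : ℕ) := PresentedGroup (dRels n)

/-- `G_{n,t}`: the quotient of `A(Δ_n)` by the normal closure of the `t`-twisted
cycle commutator `tc_t(a_1, …, a_n)`. -/
abbrev Gnt (n t : ℕ) := PresentedGroup (cycleRels n ∪ {tc (gen n) n t})

/-- `Q_{n,t}`: the quotient of `A(Δ_{t,n})` by the normal closure of the twisted
cycle commutator `tc(b_1, b_2, b_3, b_4)`. -/
abbrev Qnt (n t : ℕ) := PresentedGroup (deltaRels n t ∪ {tc (gen n) 4 1})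

/-- The signed product `y k ^ ± * y (k+1) ^ ± * ⋯`, with the signs read off a list
(`true` for the generator, `false` for its inverse). -/
def signedProd {G : Type*} [Group G] (y : ℕ → G) : ℕ → List Bool → G
  | _, [] => 1
  | k, b :: s => (if b then y k else (y k)⁻¹) * signedProd y (k + 1) s

/-- The family `y 1, …, y n` satisfies the Artin relations of the `n`-cycle. -/
structure IsCycleFamily {G : Type*} [Group G] (y : ℕ → G) (n : ℕ) : Prop where
  braid : ∀ i, 1 ≤ i → i + 1 ≤ n → BR (y i) (y (i + 1))
  braid_ends : BR (y 1) (y n)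
  comm : ∀ i j, 1 ≤ i → i + 2 ≤ j → j ≤ n → ¬ (i = 1 ∧ j = n) → Commute (y i) (y j)

section Words

variable {G : Type*} [Group G]

theorem map_mulIcc_hom {M N : Type*} [Monoid M] [Monoid N] (f : M →* N) (y : ℕ → M) (a b : ℕ) :
    f (mulIcc y a b) = mulIcc (fun i => f (y i)) a b := by
  simp [mulIcc, map_list_prod, Function.comp_def]

theorem map_tc {H : Type*} [Group H] (f : G →* H) (y : ℕ → G) (n t : ℕ) :
    f (tc y n t) = tc (fun i => f (y i)) n t := by
  simp [tc, map_commutatorElement, map_mulIcc_hom]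

theorem mulIcc_succ_left (y : ℕ → G) (k m : ℕ) :
    mulIcc y k (k + m) = y k * mulIcc y (k + 1) (k + m) := by
  have h1 : k + m + 1 - k = m + 1 := by omega
  have h2 : k + m + 1 - (k + 1) = m := by omega
  simp only [mulIcc, h1, h2, List.range_succ_eq_map, List.map_cons, List.prod_cons, List.map_map,
    Function.comp_def, Nat.succ_eq_add_one, add_zero]
  simp only [add_comm, add_left_comm]

theorem mulIcc_mul_signedProd (y : ℕ → G) (c : Bool) (m k : ℕ) (s : List Bool) :
    mulIcc (fun i => if c then y i else (y i)⁻¹) (k + 1) (k + m) * signedProd y (k + 1 + m) s =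
      signedProd y (k + 1) (List.replicate m c ++ s) := by
  induction m generalizing k with
  | zero => simp [mulIcc]
  | succ m ih =>
    have h := ih (k + 1)
    rw [show k + (m + 1) = k + 1 + m by omega, mulIcc_succ_left, mul_assoc,
      show k + 1 + (m + 1) = k + 1 + 1 + m by omega, h]
    simp [List.replicate_succ, signedProd]

theorem commute_signedProd (y : ℕ → G) (g : G) (k : ℕ) (s : List Bool)
    (h : ∀ i, k ≤ i → i < k + s.length → Commute g (y i)) : Commute g (signedProd y k s) := by
  induction s generalizing k with
  | nil => exact Commute.one_right g
  | cons b s ih =>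
    simp only [List.length_cons] at h
    have hk := h k le_rfl (by omega)
    refine Commute.mul_right ?_ (ih (k + 1) fun i hi hi' => h i (by omega) (by omega))
    split
    · exact hk
    · exact hk.inv_right

theorem BR.mul_inv_eq {u v : G} (h : BR u v) : u * v⁻¹ = v⁻¹ * (u⁻¹ * (v * u)) := by
  have h' : u * v * u = v * u * v := h
  rw [eq_inv_mul_iff_mul_eq, eq_inv_mul_iff_mul_eq, ← mul_assoc, ← mul_assoc, mul_inv_eq_iff_eq_mul]
  exact h'

theorem BR.inv_mul_eq {u v : G} (h : BR u v) : u⁻¹ * v = v * (u * (v⁻¹ * u⁻¹)) := by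
  have h' : u * v * u = v * u * v := h
  rw [inv_mul_eq_iff_eq_mul]
  simp only [← mul_assoc]
  rw [h']
  group

theorem BR.inv {u v : G} (h : BR u v) : BR u⁻¹ v⁻¹ := by
  have h' := congrArg (·⁻¹) (show u * v * u = v * u * v from h)
  simpa [BR, mul_assoc] using h'

theorem commute_of_mem_closure {S : Set G} {g c : G} (hc : c ∈ Subgroup.closure S)
    (h : ∀ x ∈ S, Commute g x) : Commute g c := by
  induction hc using Subgroup.closure_induction with
  | mem x hx => exact h x hx
  | one => exact Commute.one_right g
  | mul x y _ _ hx hy => exact hx.mul_right hy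
  | inv x _ hx => exact hx.inv_right

/-- Permuting the signs of a signed product changes it by a left factor in the later generators
and a right factor in the earlier ones. -/
theorem IsCycleFamily.signedProd_perm {y : ℕ → G} {n : ℕ} (hy : IsCycleFamily y n)
    {s₁ s₂ : List Bool} (hs : s₁.Perm s₂) (k : ℕ) (hk : 2 ≤ k) (hkn : k + s₁.length ≤ n) :
    ∃ c ∈ Subgroup.closure (y '' {i | k < i ∧ i < k + s₁.length}),
      ∃ d ∈ Subgroup.closure (y '' {i | k ≤ i ∧ i + 1 < k + s₁.length}),
        signedProd y k s₁ = c * signedProd y k s₂ * d := by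
  induction hs generalizing k with
  | nil => exact ⟨1, one_mem _, 1, one_mem _, by simp⟩
  | @cons b s₁ s₂ _ ih =>
    simp only [List.length_cons] at hkn ⊢
    obtain ⟨c, hc, d, hd, h⟩ := ih (k + 1) (by omega) (by omega)
    have hyc : Commute (y k) c := by
      refine commute_of_mem_closure hc ?_
      rintro _ ⟨i, ⟨hi, hi'⟩, rfl⟩
      exact hy.comm k i (by omega) (by omega) (by omega) (by omega)
    have hbc : Commute (if b then y k else (y k)⁻¹) c := by
      split
      · exact hyc
      · exact hyc.inv_left
    refine ⟨c, Subgroup.closure_mono (Set.image_mono ?_) hc, d,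
      Subgroup.closure_mono (Set.image_mono ?_) hd, ?_⟩
    · rintro i ⟨hi, hi'⟩
      exact ⟨by omega, by omega⟩
    · rintro i ⟨hi, hi'⟩
      exact ⟨by omega, by omega⟩
    · simp only [signedProd, h]
      rw [← mul_assoc, ← mul_assoc, ← mul_assoc, hbc.eq]
  | swap a b s =>
    simp only [List.length_cons] at hkn ⊢
    have hc : y (k + 1) ∈
        Subgroup.closure (y '' {i | k < i ∧ i < k + (s.length + 1 + 1)}) :=
      Subgroup.subset_closure ⟨k + 1, ⟨by omega, by omega⟩, rfl⟩
    have hd : y k ∈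
        Subgroup.closure (y '' {i | k ≤ i ∧ i + 1 < k + (s.length + 1 + 1)}) :=
      Subgroup.subset_closure ⟨k, ⟨by omega, by omega⟩, rfl⟩
    have hw : Commute (y k) (signedProd y (k + 1 + 1) s) :=
      commute_signedProd y _ _ s fun i hi hi' =>
        hy.comm k i (by omega) (by omega) (by omega) (by omega)
    have hb := hy.braid k (by omega) (by omega)
    rcases a with - | - <;> rcases b with - | -
    · exact ⟨1, one_mem _, 1, one_mem _, by simp⟩
    · refine ⟨_, inv_mem hc, _, hd, ?_⟩
      simp only [signedProd, if_true, Bool.false_eq_true, if_false]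
      rw [← mul_assoc (y k), hb.mul_inv_eq]
      simp only [mul_assoc, hw.eq]
    · refine ⟨_, hc, _, inv_mem hd, ?_⟩
      simp only [signedProd, if_true, Bool.false_eq_true, if_false]
      rw [← mul_assoc (y k)⁻¹, hb.inv_mul_eq]
      simp only [mul_assoc, hw.inv_left.eq]
    · exact ⟨1, one_mem _, 1, one_mem _, by simp⟩
  | @trans s₁ s₂ s₃ h₁₂ _ ih₁ ih₂ =>
    obtain ⟨c, hc, d, hd, h⟩ := ih₁ k hk hkn
    obtain ⟨c', hc', d', hd', h'⟩ := ih₂ k hk (h₁₂.length_eq ▸ hkn)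
    rw [← h₁₂.length_eq] at hc' hd'
    exact ⟨c * c', mul_mem hc hc', d' * d, mul_mem hd' hd, by rw [h, h']; group⟩

theorem tc_eq_commutator_signedProd (y : ℕ → G) (t s : ℕ) :
    tc y (t + s + 2) t =
      ⁅y 1, signedProd y 2 (List.replicate t false ++ List.replicate s true) * y (t + s + 2) *
        (signedProd y 2 (List.replicate t false ++ List.replicate s true))⁻¹⁆ := by
  have h1 := mulIcc_mul_signedProd y false t 1 (List.replicate s true)
  have h2 := mulIcc_mul_signedProd y true s (t + 1) []
  simp only [if_true, Bool.false_eq_true, if_false, signedProd, mul_one, List.append_nil,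
    Nat.reduceAdd] at h1 h2
  rw [← h1, show 2 + t = t + 1 + 1 by omega, ← h2, tc, show t + s + 2 - 1 = t + 1 + s by omega,
    add_comm 1 t]
  simp only [mul_inv_rev, mul_assoc]

theorem signedProd_inv (y : ℕ → G) (k : ℕ) (s : List Bool) :
    signedProd (fun i => (y i)⁻¹) k s = signedProd y k (s.map not) := by
  induction s generalizing k with
  | nil => rfl
  | cons b s ih => cases b <;> simp [signedProd, ih]

theorem IsCycleFamily.inv {y : ℕ → G} {n : ℕ} (hy : IsCycleFamily y n) :
    IsCycleFamily (fun i => (y i)⁻¹) n where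
  braid i hi hi' := (hy.braid i hi hi').inv
  braid_ends := hy.braid_ends.inv
  comm i j hi hij hj h := (hy.comm i j hi hij hj h).inv_inv

theorem IsCycleFamily.tc_inv_eq_one {y : ℕ → G} {t s : ℕ} (hy : IsCycleFamily y (t + s + 2))
    (h : tc y (t + s + 2) s = 1) : tc (fun i => (y i)⁻¹) (t + s + 2) t = 1 := by
  rw [tc_eq_commutator_signedProd, signedProd_inv, commutatorElement_eq_one_iff_commute]
  simp only [List.map_append, List.map_replicate, Bool.not_false, Bool.not_true]
  rw [show t + s + 2 = s + t + 2 by omega, tc_eq_commutator_signedProd,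
    commutatorElement_eq_one_iff_commute] at h
  rw [show t + s + 2 = s + t + 2 by omega] at hy ⊢
  obtain ⟨c, hc, d, hd, hw⟩ := hy.signedProd_perm
    (List.perm_append_comm (l₁ := List.replicate t true) (l₂ := List.replicate s false)) 2 le_rfl
    (by simp; omega)
  simp only [List.length_append, List.length_replicate] at hc hd
  have hc1 : Commute (y 1) c := by
    refine commute_of_mem_closure hc ?_
    rintro _ ⟨i, ⟨hi, hi'⟩, rfl⟩
    exact hy.comm 1 i le_rfl (by omega) (by omega) (by omega)
  have hdn : Commute (y (s + t + 2)) d := by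
    refine commute_of_mem_closure hd ?_
    rintro _ ⟨i, ⟨hi, hi'⟩, rfl⟩
    exact (hy.comm i _ (by omega) (by omega) le_rfl (by omega)).symm
  rw [hw]
  generalize signedProd y 2 (List.replicate s false ++ List.replicate t true) = w at h
  have hconj : c * w * d * (y (s + t + 2))⁻¹ * (c * w * d)⁻¹ =
      c * (w * y (s + t + 2) * w⁻¹)⁻¹ * c⁻¹ := by
    have hdn' : d * (y (s + t + 2))⁻¹ = (y (s + t + 2))⁻¹ * d := hdn.symm.inv_right.eq
    rw [mul_assoc (c * w) d, hdn']
    group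
  rw [hconj]
  exact ((hc1.mul_right h.inv_right).mul_right hc1.inv_right).inv_left

end Words

/-- The generators satisfy the relations of the cycle in any group where the relators vanish. -/
theorem isCycleFamily_of_rels {G : Type*} [Group G] {n : ℕ} (hn : 3 ≤ n)
    (f : FreeGroup (Fin n) →* G) (hf : ∀ w ∈ cycleRels n, f w = 1) :
    IsCycleFamily (fun i => f (gen n i)) n := by
  have hbr : ∀ i j, 1 ≤ i → i < j → j ≤ n → cycEdge n i j → BR (f (gen n i)) (f (gen n j)) := by
    intro i j hi hij hj he
    have := hf _ ⟨i, j, hi, hij, hj, Or.inl ⟨he, rfl⟩⟩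
    simpa only [BR, braidRel, map_mul, map_inv, mul_inv_eq_one] using this
  refine ⟨fun i hi hi' => hbr i (i + 1) hi (by omega) hi' (Or.inl ⟨hi, hi', rfl⟩),
    hbr 1 n le_rfl (by omega) le_rfl (Or.inr ⟨rfl, rfl⟩), fun i j hi hij hj hne => ?_⟩
  have := hf _ ⟨i, j, hi, by omega, hj, Or.inr ⟨by unfold cycEdge; omega, rfl⟩⟩
  rwa [map_commutatorElement, commutatorElement_eq_one_iff_commute] at this

theorem IsCycleFamily.map_cycleRels {G : Type*} [Group G] {n : ℕ} {f : FreeGroup (Fin n) →* G}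
    (hf : IsCycleFamily (fun i => f (gen n i)) n) : ∀ w ∈ cycleRels n, f w = 1 := by
  rintro w ⟨i, j, hi, hij, hj, ⟨he, rfl⟩ | ⟨he, rfl⟩⟩
  · simp only [braidRel, map_mul, map_inv, mul_inv_eq_one]
    rcases he with ⟨_, hi', rfl⟩ | ⟨rfl, rfl⟩
    · exact hf.braid i hi hi'
    · exact hf.braid_ends
  · rw [map_commutatorElement, commutatorElement_eq_one_iff_commute]
    unfold cycEdge at he
    exact hf.comm i j hi (by omega) hj (by omega)

theorem lift_inv_eq_one {n t s : ℕ} (hn : 3 ≤ n) (hts : t + s + 2 = n) :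
    ∀ w ∈ cycleRels n ∪ {tc (gen n) n t},
      FreeGroup.lift (fun x : Fin n => (PresentedGroup.of x : Gnt n s)⁻¹) w = 1 := by
  have hgen : ∀ i, FreeGroup.lift (fun x : Fin n => (PresentedGroup.of x : Gnt n s)⁻¹) (gen n i) =
      (PresentedGroup.mk (cycleRels n ∪ {tc (gen n) n s}) (gen n i))⁻¹ := by
    intro i
    simp only [gen, dif_pos (show 0 < n by omega), FreeGroup.lift_apply_of]
    rfl
  have hfam := isCycleFamily_of_rels hn (PresentedGroup.mk (cycleRels n ∪ {tc (gen n) n s}))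
    fun w hw => PresentedGroup.one_of_mem (Or.inl hw)
  have htc := PresentedGroup.one_of_mem (rels := cycleRels n ∪ {tc (gen n) n s}) (Or.inr rfl)
  rw [map_tc] at htc
  rintro w (hw | rfl)
  · refine IsCycleFamily.map_cycleRels ?_ w hw
    simpa only [hgen] using hfam.inv
  · rw [map_tc]
    simp only [hgen]
    subst hts
    exact hfam.tc_inv_eq_one htc

/-- The homomorphism `G_{n,t} → G_{n,s}`, for `t + s = n - 2`, inverting each generator. -/
def invHom {n t s : ℕ} (hn : 3 ≤ n) (hts : t + s + 2 = n) : Gnt n t →* Gnt n s :=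
  PresentedGroup.toGroup (lift_inv_eq_one hn hts)

theorem invHom_of {n t s : ℕ} (hn : 3 ≤ n) (hts : t + s + 2 = n) (x : Fin n) :
    invHom hn hts (PresentedGroup.of x) = (PresentedGroup.of x)⁻¹ :=
  PresentedGroup.toGroup.of _

/-- for `n ≥ 4` and `1 ≤ t ≤ n-3`, `G_{n,t} ≅ G_{n,n-2-t}`, via an
isomorphism induced by the automorphism of `A(Δ_n)` sending each generator `a_i`
to `a_i⁻¹`. -/
theorem Gnt_isom_Gnt_symm (n t : ℕ) (hn : 4 ≤ n) (ht1 : 1 ≤ t) (ht2 : t ≤ n - 3) :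
    ∃ e : Gnt n t ≃* Gnt n (n - 2 - t),
      ∀ x : Fin n, e (PresentedGroup.of x) = (PresentedGroup.of x)⁻¹ := by
  have h₁ : t + (n - 2 - t) + 2 = n := by omega
  have h₂ : n - 2 - t + t + 2 = n := by omega
  have h₃ : 3 ≤ n := by omega
  refine ⟨MonoidHom.toMulEquiv (invHom h₃ h₁) (invHom h₃ h₂) ?_ ?_, invHom_of h₃ h₁⟩
  · ext x
    simp [invHom_of]
  · ext x
    simp [invHom_of]

end ArtinPaper
end

section
/- Let G be a group and let f, g, h ∈ G satisfy BR(f,g), BR(g,h) and CM(f,h). Then CM(g, f g h g^{−1} f^{−1}), CM(f^{−1} g f, h^{−1} g h), and CM(f g f^{−1}, h g h^{−1}). -/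
/- Scaffolding: braid/commuting predicates, ordered products, cycle and twisted
cycle commutators, and the Artin groups of the diagrams `Δ_n`, `Δ_{t,n}`, `D_n`
(generators numbered `1, …, n` as in the paper, realized on the index type `Fin n`). -/

namespace ArtinPaper

open scoped commutatorElement

/-- Conjugating `v` by `u` agrees with conjugating `u` by `v⁻¹` for braiding `u`, `v`. -/
theorem BR.mul_mul_inv {G : Type*} [Group G] {u v : G} (h : BR u v) :
    u * v * u⁻¹ = v⁻¹ * u * v := by
  rw [mul_inv_eq_iff_eq_mul, mul_assoc, mul_assoc, eq_inv_mul_iff_mul_eq, ← mul_assoc,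
    ← mul_assoc]
  exact h.symm

/-- Conjugating `v` by `u⁻¹` agrees with conjugating `u` by `v` for braiding `u`, `v`. -/
theorem BR.inv_mul_mul {G : Type*} [Group G] {u v : G} (h : BR u v) :
    u⁻¹ * v * u = v * u * v⁻¹ :=
  (BR.mul_mul_inv (Eq.symm h)).symm

/-- Conjugation preserves commuting pairs. -/
theorem CM.conj {G : Type*} [Group G] {u v : G} (h : CM u v) (w : G) :
    CM (w * u * w⁻¹) (w * v * w⁻¹) :=
  (Commute.conj_iff w).2 h

/-- Lemma 2.2(ii): if `BR f g`, `BR g h`, `CM f h`, then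
`CM g (f g h g⁻¹ f⁻¹)`, `CM (f⁻¹ g f) (h⁻¹ g h)`, and `CM (f g f⁻¹) (h g h⁻¹)`. -/
theorem brcm_commutes {G : Type*} [Group G] (f g h : G)
    (h1 : BR f g) (h2 : BR g h) (h3 : CM f h) :
    CM g (f * g * h * g⁻¹ * f⁻¹) ∧ CM (f⁻¹ * g * f) (h⁻¹ * g * h) ∧
      CM (f * g * f⁻¹) (h * g * h⁻¹) := by
  refine ⟨?_, ?_, ?_⟩
  · have hg : g = f * g * f * (f * g)⁻¹ := by
      rw [eq_mul_inv_iff_mul_eq, ← mul_assoc]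
      exact h1.symm
    have hc := h3.conj (f * g)
    rw [← hg] at hc
    simpa only [mul_inv_rev, ← mul_assoc] using hc
  · rw [h1.inv_mul_mul, BR.inv_mul_mul (Eq.symm h2)]
    exact h3.conj g
  · rw [h1.mul_mul_inv, BR.mul_mul_inv (Eq.symm h2)]
    simpa only [inv_inv] using h3.conj g⁻¹

end ArtinPaper
end

section
/- Let G be a group, let k ≥ 2, and let y_1, …, y_k ∈ G satisfy BR(y_i, y_{i+1}) for 1 ≤ i < k and CM(y_i, y_j) for 1 ≤ i < j−1 ≤ k−1. Let w := y_1 y_2 ⋯ y_{k−1} y_k y_{k−1}^{−1} ⋯ y_2^{−1} y_1^{−1}. Then CM(y_i, w) for all i with 2 ≤ i ≤ k−1. -/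
/- Scaffolding: braid/commuting predicates, ordered products, cycle and twisted
cycle commutators, and the Artin groups of the diagrams `Δ_n`, `Δ_{t,n}`, `D_n`
(generators numbered `1, …, n` as in the paper, realized on the index type `Fin n`). -/

namespace ArtinPaper

open scoped commutatorElement

theorem mulIcc_succ {M : Type*} [Monoid M] (y : ℕ → M) {a b : ℕ} (h : a ≤ b + 1) :
    mulIcc y a (b + 1) = mulIcc y a b * y (b + 1) := by
  have hlen : b + 1 + 1 - a = (b + 1 - a) + 1 := by omega
  have hlast : a + (b + 1 - a) = b + 1 := by omega
  simp [mulIcc, hlen, List.range_succ, hlast]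

theorem commute_mulIcc_left {M : Type*} [Monoid M] {y : ℕ → M} {a b : ℕ} {x : M}
    (h : ∀ i, a ≤ i → i ≤ b → Commute (y i) x) : Commute (mulIcc y a b) x := by
  refine Commute.list_prod_left _ _ fun z hz => ?_
  obtain ⟨i, hi, rfl⟩ := List.mem_map.1 hz
  have := List.mem_range.1 hi
  exact h _ (by omega) (by omega)

/-- In a braid group, conjugation by `y 1 * ⋯ * y n` shifts the generators by one. -/
theorem semiconjBy_mulIcc {G : Type*} [Group G] {y : ℕ → G} {n : ℕ}
    (hbr : ∀ i, 1 ≤ i → i < n → BR (y i) (y (i + 1)))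
    (hcm : ∀ i j, 1 ≤ i → i + 1 < j → j ≤ n → CM (y i) (y j))
    {i : ℕ} (hi : 1 ≤ i) (hin : i < n) :
    SemiconjBy (mulIcc y 1 n) (y i) (y (i + 1)) := by
  induction n with
  | zero => omega
  | succ n ih =>
    rw [mulIcc_succ y (by omega)]
    rcases Nat.lt_succ_iff_lt_or_eq.1 hin with h | rfl
    · exact (ih (fun j hj hjn => hbr j hj (by omega))
        (fun j l hj hjl hl => hcm j l hj hjl (by omega)) h).mul_left
        (hcm i (n + 1) hi (by omega) le_rfl).symm
    · obtain ⟨m, rfl⟩ := Nat.exists_eq_add_of_le' hi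
      rw [mulIcc_succ y (by omega), mul_assoc]
      have hcomm : Commute (mulIcc y 1 m) (y (m + 1 + 1)) :=
        commute_mulIcc_left fun j hj hjm => hcm j _ hj (by omega) le_rfl
      exact SemiconjBy.mul_left hcomm
        ((hbr (m + 1) hi hin).trans (mul_assoc _ _ _))

/-- Lemma 2.3(iii): with braid-group-like relations among
`y 1, …, y k` and `w = y₁ ⋯ y_{k-1} y_k y_{k-1}⁻¹ ⋯ y₁⁻¹`, we have `CM (y i) w`
for `2 ≤ i ≤ k-1`. -/
theorem longconj_commutes {G : Type*} [Group G] (k : ℕ) (hk : 2 ≤ k) (y : ℕ → G)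
    (hbr : ∀ i, 1 ≤ i → i < k → BR (y i) (y (i + 1)))
    (hcm : ∀ i j, 1 ≤ i → i + 1 < j → j ≤ k → CM (y i) (y j)) :
    ∀ i, 2 ≤ i → i ≤ k - 1 →
      CM (y i) (mulIcc y 1 (k - 1) * y k * (mulIcc y 1 (k - 1))⁻¹) := by
  intro i hi hik
  obtain ⟨j, rfl⟩ := Nat.exists_eq_add_of_le' (show 1 ≤ i by omega)
  have hshift : SemiconjBy (mulIcc y 1 (k - 1)) (y j) (y (j + 1)) :=
    semiconjBy_mulIcc (fun l hl hlk => hbr l hl (by omega))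
      (fun l m hl hlm hm => hcm l m hl hlm (by omega)) (by omega) (by omega)
  have hcomm : Commute (y j) (y k) := hcm j k (by omega) (by omega) le_rfl
  have hconj := hcomm.conj (mulIcc y 1 (k - 1))
  rwa [hshift.eq, mul_inv_cancel_right] at hconj

end ArtinPaper
end

section
/- Let n ≥ 4, let 1 ≤ t ≤ n−3, and let a_1, a_2, …, a_n be elements of a group G satisfying the defining relations of A(Δ_n), i.e. BR(a_i, a_{i+1}) for 1 ≤ i ≤ n−1, BR(a_n, a_1), and CM(a_i, a_j) for all other pairs i < j. Let I = {2, 3, …, n−2}, let S ⊆ I with |S| = t, and define ε_i = −1 if i ∈ S and ε_i = 1 if i ∈ {2,…,n−1}∖S. Then tc_t(a_1, …, a_n) = 1 in G if and only if [a_1, a_2^{ε_2} ⋯ a_{n−1}^{ε_{n−1}} a_n a_{n−1}^{−ε_{n−1}} ⋯ a_2^{−ε_2}] = 1 in G. -/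
/- Scaffolding: braid/commuting predicates, ordered products, cycle and twisted
cycle commutators, and the Artin groups of the diagrams `Δ_n`, `Δ_{t,n}`, `D_n`
(generators numbered `1, …, n` as in the paper, realized on the index type `Fin n`). -/

namespace ArtinPaper

open scoped commutatorElement

theorem mulIcc_split {M : Type*} [Monoid M] (y : ℕ → M) {a b c : ℕ} (hac : a ≤ c + 1)
    (hcb : c ≤ b) : mulIcc y a b = mulIcc y a c * mulIcc y (c + 1) b := by
  unfold mulIcc
  have h : b + 1 - a = (c + 1 - a) + (b + 1 - (c + 1)) := by omega
  rw [h, List.range_add, List.map_append, List.prod_append, List.map_map]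
  congr 3
  funext i
  simp only [Function.comp_apply]
  congr 1
  omega

theorem mulIcc_self {M : Type*} [Monoid M] (y : ℕ → M) (a : ℕ) : mulIcc y a a = y a := by
  simp [mulIcc]

theorem mulIcc_congr {M : Type*} [Monoid M] {y z : ℕ → M} {a b : ℕ}
    (h : ∀ i, a ≤ i → i ≤ b → y i = z i) : mulIcc y a b = mulIcc z a b := by
  unfold mulIcc
  congr 1
  refine List.map_congr_left fun i hi => h _ (by omega) ?_
  have := List.mem_range.1 hi
  omega

theorem commute_mulIcc {M : Type*} [Monoid M] {x : M} {y : ℕ → M} {a b : ℕ}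
    (h : ∀ i, a ≤ i → i ≤ b → Commute x (y i)) : Commute x (mulIcc y a b) := by
  refine Commute.list_prod_right _ _ fun z hz => ?_
  obtain ⟨i, hi, rfl⟩ := List.mem_map.1 hz
  have := List.mem_range.1 hi
  exact h _ (by omega) (by omega)

theorem mulIcc_split_pair {M : Type*} [Monoid M] (y : ℕ → M) {a b i : ℕ} (ha : a ≤ i)
    (hi : 1 ≤ i) (hb : i + 1 ≤ b) :
    mulIcc y a b = mulIcc y a (i - 1) * (y i * y (i + 1)) * mulIcc y (i + 2) b := by
  obtain ⟨k, rfl⟩ : ∃ k, i = k + 1 := ⟨i - 1, by omega⟩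
  rw [mulIcc_split y (c := k) (by omega) (by omega),
    mulIcc_split y (a := k + 1) (c := k + 1) (by omega) (by omega),
    mulIcc_split y (a := k + 1 + 1) (c := k + 1 + 1) (by omega) (by omega),
    mulIcc_self, mulIcc_self]
  simp only [Nat.add_sub_cancel, mul_assoc]

/-- Exchanging the exponents of two adjacent braiding factors conjugates by the second one. -/
theorem conj_inv_mul_eq {G : Type*} [Group G] {p x y v : G} (hxy : BR x y)
    (hxv : Commute x v) (hyp : Commute y p) :
    (p * (x⁻¹ * y)) * v * (p * (x⁻¹ * y))⁻¹ =
      y * ((p * (x * y⁻¹)) * v * (p * (x * y⁻¹))⁻¹) * y⁻¹ := by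
  have hb : x⁻¹ * y * x = y * x * y⁻¹ := by
    have h : x * y * x = y * x * y := hxy
    rw [eq_mul_inv_iff_mul_eq, mul_assoc, mul_assoc, inv_mul_eq_iff_eq_mul, ← mul_assoc,
      ← mul_assoc, h]
  calc (p * (x⁻¹ * y)) * v * (p * (x⁻¹ * y))⁻¹
      = (p * (x⁻¹ * y)) * (x * v * x⁻¹) * (p * (x⁻¹ * y))⁻¹ := by
        rw [hxv.eq, mul_inv_cancel_right]
    _ = (p * (x⁻¹ * y * x)) * v * (p * (x⁻¹ * y * x))⁻¹ := by group
    _ = (p * y * (x * y⁻¹)) * v * (p * y * (x * y⁻¹))⁻¹ := by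
        rw [hb]; simp only [mul_assoc]
    _ = _ := by rw [← hyp.eq]; group

theorem Commute.conj_right_iff_of_commute {G : Type*} [Group G] {b y w : G}
    (h : Commute y b) : Commute b (y * w * y⁻¹) ↔ Commute b w := by
  have hb : b = y * b * y⁻¹ := by rw [h.eq, mul_inv_cancel_right]
  conv_lhs => rw [hb]
  exact Commute.conj_iff y

theorem eq_Ico_of_forall_succ_mem {S : Finset ℕ} {m : ℕ} (hm : ∀ j ∈ S, m ≤ j)
    (h : ∀ j, m ≤ j → j + 1 ∈ S → j ∈ S) : S = Finset.Ico m (m + S.card) := by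
  have hdown : ∀ d j, m ≤ j → j + d ∈ S → j ∈ S := by
    intro d
    induction d with
    | zero => exact fun j _ hj => hj
    | succ d ih => exact fun j hmj hj => ih j hmj (h _ (by omega) hj)
  refine Finset.eq_of_subset_of_card_le (fun k hk => ?_) (by simp)
  have hsub : Finset.Icc m k ⊆ S := fun j hj => by
    rw [Finset.mem_Icc] at hj
    exact hdown (k - j) j hj.1 (by rwa [Nat.add_sub_cancel' hj.2])
  have hcard := Finset.card_le_card hsub
  have := hm k hk
  rw [Nat.card_Icc] at hcard
  rw [Finset.mem_Ico]
  omega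

/-- The sequence obtained from `a` by inverting the entries with index in `S`. -/
abbrev invOn {G : Type*} [Group G] (a : ℕ → G) (S : Finset ℕ) (i : ℕ) : G :=
  if i ∈ S then (a i)⁻¹ else a i

theorem Commute.invOn_right {G : Type*} [Group G] {x : G} {a : ℕ → G} {i : ℕ}
    (h : Commute x (a i)) (S : Finset ℕ) : Commute x (invOn a S i) := by
  unfold invOn
  split_ifs
  exacts [h.inv_right, h]

theorem commute_conj_invOn_swap {G : Type*} [Group G] {n : ℕ} {a : ℕ → G}
    (hbr : ∀ i, 1 ≤ i → i + 1 ≤ n → BR (a i) (a (i + 1)))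
    (hcm : ∀ i j, 1 ≤ i → i < j → j ≤ n → j ≠ i + 1 → ¬(i = 1 ∧ j = n) →
      CM (a i) (a j))
    {S T : Finset ℕ} {i : ℕ} (hi : 2 ≤ i) (hin : i + 2 ≤ n)
    (hiS : i ∉ S) (hiS' : i + 1 ∈ S) (hiT : i ∈ T) (hiT' : i + 1 ∉ T)
    (hST : ∀ j, j ≠ i → j ≠ i + 1 → (j ∈ S ↔ j ∈ T)) :
    Commute (a 1) (mulIcc (invOn a S) 2 (n - 1) * a n * (mulIcc (invOn a S) 2 (n - 1))⁻¹) ↔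
    Commute (a 1) (mulIcc (invOn a T) 2 (n - 1) * a n * (mulIcc (invOn a T) 2 (n - 1))⁻¹) := by
  have hP : mulIcc (invOn a S) 2 (i - 1) = mulIcc (invOn a T) 2 (i - 1) :=
    mulIcc_congr fun j _ _ => by simp only [invOn, hST j (by omega) (by omega)]
  have hQ : mulIcc (invOn a S) (i + 2) (n - 1) = mulIcc (invOn a T) (i + 2) (n - 1) :=
    mulIcc_congr fun j _ _ => by simp only [invOn, hST j (by omega) (by omega)]
  rw [mulIcc_split_pair (invOn a S) hi (by omega) (by omega),
    mulIcc_split_pair (invOn a T) hi (by omega) (by omega), hP, hQ]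
  simp only [invOn, hiS, hiS', hiT, hiT', if_true, if_false]
  set p := mulIcc (invOn a T) 2 (i - 1)
  set q := mulIcc (invOn a T) (i + 2) (n - 1)
  have hq : Commute (a i) q := commute_mulIcc fun j _ _ => Commute.invOn_right
    (hcm i j (by omega) (by omega) (by omega) (by omega) (by omega)) T
  have hn : Commute (a i) (a n) :=
    hcm i n (by omega) (by omega) le_rfl (by omega) (by omega)
  have hp : Commute (a (i + 1)) p := commute_mulIcc fun j _ _ => Commute.invOn_right
    (Commute.symm (hcm j (i + 1) (by omega) (by omega) (by omega) (by omega) (by omega))) T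
  have h1 : Commute (a (i + 1)) (a 1) :=
    Commute.symm (hcm 1 (i + 1) le_rfl (by omega) (by omega) (by omega) (by omega))
  have hv : Commute (a i) (q * a n * q⁻¹) := (hq.mul_right hn).mul_right hq.inv_right
  have key := conj_inv_mul_eq (hbr i (by omega) (by omega)) hv hp
  have hassoc (u : G) : u * q * a n * (u * q)⁻¹ = u * (q * a n * q⁻¹) * u⁻¹ := by group
  rw [hassoc, hassoc, key, Commute.conj_right_iff_of_commute h1]

theorem commute_conj_invOn_iff_Ico {G : Type*} [Group G] {n : ℕ} {a : ℕ → G}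
    (hbr : ∀ i, 1 ≤ i → i + 1 ≤ n → BR (a i) (a (i + 1)))
    (hcm : ∀ i j, 1 ≤ i → i < j → j ≤ n → j ≠ i + 1 → ¬(i = 1 ∧ j = n) →
      CM (a i) (a j))
    (S : Finset ℕ) (hS : S ⊆ Finset.Icc 2 (n - 2)) :
    Commute (a 1) (mulIcc (invOn a S) 2 (n - 1) * a n * (mulIcc (invOn a S) 2 (n - 1))⁻¹) ↔
    Commute (a 1) (mulIcc (invOn a (Finset.Ico 2 (2 + S.card))) 2 (n - 1) * a n *
      (mulIcc (invOn a (Finset.Ico 2 (2 + S.card))) 2 (n - 1))⁻¹) := by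
  induction hs : ∑ j ∈ S, j using Nat.strong_induction_on generalizing S with
  | _ s ih =>
  by_cases h : ∀ j, 2 ≤ j → j + 1 ∈ S → j ∈ S
  · rw [← eq_Ico_of_forall_succ_mem (fun j hj => (Finset.mem_Icc.1 (hS hj)).1) h]
  · push Not at h
    obtain ⟨i, hi, hiS', hiS⟩ := h
    have hin := (Finset.mem_Icc.1 (hS hiS')).2
    have hi' : i ∉ S.erase (i + 1) := fun hmem => hiS (Finset.mem_of_mem_erase hmem)
    have hsum : ∑ j ∈ insert i (S.erase (i + 1)), j < s := by
      rw [Finset.sum_insert hi', ← hs, ← Finset.add_sum_erase S (fun j => j) hiS']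
      omega
    have hcard : (insert i (S.erase (i + 1))).card = S.card := by
      rw [Finset.card_insert_of_notMem hi', Finset.card_erase_add_one hiS']
    have hsub : insert i (S.erase (i + 1)) ⊆ Finset.Icc 2 (n - 2) :=
      Finset.insert_subset (Finset.mem_Icc.2 ⟨hi, by omega⟩) ((Finset.erase_subset _ _).trans hS)
    have := ih _ hsum _ hsub rfl
    rw [hcard] at this
    rw [← this]
    refine commute_conj_invOn_swap hbr hcm hi (by omega) hiS hiS' (by simp) (by simp) ?_
    intro j hj hj'
    simp [hj, hj']

/-- Lemma 2.5(ii): if `a 1, …, a n` satisfy the defining relations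
of `A(Δ_n)`, `1 ≤ t ≤ n-3`, and `S ⊆ {2, …, n-2}` with `|S| = t`, setting
`ε_i = -1` for `i ∈ S` and `ε_i = 1` otherwise, then `tc_t(a_1,…,a_n) = 1` iff
`[a_1, a_2^{ε_2} ⋯ a_{n-1}^{ε_{n-1}} a_n a_{n-1}^{-ε_{n-1}} ⋯ a_2^{-ε_2}] = 1`. -/
theorem tc_signs_equiv {G : Type*} [Group G] (n t : ℕ) (hn : 4 ≤ n)
    (ht1 : 1 ≤ t) (ht2 : t ≤ n - 3) (a : ℕ → G)
    (hbr : ∀ i, 1 ≤ i → i + 1 ≤ n → BR (a i) (a (i + 1)))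
    (hbr' : BR (a n) (a 1))
    (hcm : ∀ i j, 1 ≤ i → i < j → j ≤ n → j ≠ i + 1 → ¬(i = 1 ∧ j = n) →
      CM (a i) (a j))
    (S : Finset ℕ) (hS : S ⊆ Finset.Icc 2 (n - 2)) (hScard : S.card = t) :
    (tc a n t = 1 ↔
      ⁅a 1, mulIcc (fun i => if i ∈ S then (a i)⁻¹ else a i) 2 (n - 1) * a n *
          (mulIcc (fun i => if i ∈ S then (a i)⁻¹ else a i) 2 (n - 1))⁻¹⁆ = 1) := by
  rw [commutatorElement_eq_one_iff_commute, tc, commutatorElement_eq_one_iff_commute,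
    commute_conj_invOn_iff_Ico hbr hcm S hS, hScard,
    mulIcc_split (invOn a _) (c := t + 1) (by omega) (by omega),
    mulIcc_congr (y := invOn a _) (z := fun i => (a i)⁻¹) (a := 2) (b := t + 1)
      fun i _ _ => if_pos (Finset.mem_Ico.2 (by omega)),
    mulIcc_congr (y := invOn a _) (z := a) (a := t + 1 + 1)
      fun i _ _ => if_neg (by rw [Finset.mem_Ico]; omega)]
  simp only [mul_assoc, mul_inv_rev]

end ArtinPaper
end
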